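/- Let f : ℝ → ℝ be infinitely differentiable and let n ≥ 1. Then the n-th iterated total differential of the term f̄(x₀) satisfies 𝐝ⁿ(f̄(x₀)) ≡ Σ_{π ∈ Πₙ} I(π), where Πₙ is the set of all partitions of {1, …, n} and, for a partition π = {B₁, …, B_k}, I(π) denotes the term f̄⁽ᵏ⁾(x₀) · d^{|B₁|}x₀ · d^{|B₂|}x₀ ⋯ d^{|B_k|}x₀ (with f⁽ᵏ⁾ the k-th classical derivative of f and d^{m}x₀ the m-fold differential variable of x₀). -/

import Mathlib

open Filter Topology

/-- Variables: `(m, i)` represents the `m`-fold differential `dᵐxᵢ` of the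
precalculus variable `xᵢ`.  Unique readability holds by construction. -/
abbrev Var : Type := ℕ × ℕ

/-- The differential variable `dv` associated to a variable `v`. -/
def dvar (v : Var) : Var := (v.1 + 1, v.2)

/-- Terms of differential calculus. -/
inductive Term : Type where
  | var : Var → Term
  | const : ℝ → Term
  | app : (n : ℕ) → ((Fin n → ℝ) → ℝ) → (Fin n → Term) → Term

/-- Assignments of real values to variables. -/
abbrev Assignment : Type := Var → ℝ

/-- Interpretation `Tˢ` of a term `T` under an assignment `s`. -/
noncomputable def interp : Term → Assignment → ℝ
  | .var v, s => s v
  | .const r, _ => r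
  | .app _ f U, s => f fun i => interp (U i) s

/-- The (finite set of) free variables of a term. -/
def FV : Term → Finset Var
  | .var v => {v}
  | .const _ => ∅
  | .app _ _ U => Finset.univ.biUnion fun i => FV (U i)

/-- Semantic equivalence of terms. -/
def TermEquiv (T U : Term) : Prop := ∀ s : Assignment, interp T s = interp U s

/-- The ordered free variables of `T`: its free variables listed in a fixed
canonical order. -/
noncomputable def OFV (T : Term) : List Var := (FV T).toList

/-- `T` is everywhere-differentiable with respect to the variable `w`. -/
def EDiff (T : Term) (w : Var) : Prop :=
  ∀ s : Assignment, ∃ L : ℝ,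
    Tendsto (fun h : ℝ => (interp T (Function.update s w (s w + h)) - interp T s) / h)
      (𝓝[≠] 0) (𝓝 L)

/-- The defining limit of the partial derivative of `T` w.r.t. `w` at `s`. -/
noncomputable def pderivLim (T : Term) (w : Var) (s : Assignment) : ℝ :=
  limUnder (𝓝[≠] (0 : ℝ))
    fun h : ℝ => (interp T (Function.update s w (s w + h)) - interp T s) / h

/-- The canonical assignment sending the `i`-th ordered free variable of `T`
to `r i` (and all other variables to `0`). -/
noncomputable def canonAsgn (T : Term) (r : Fin (OFV T).length → ℝ) : Assignment :=
  fun v =>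
    if hv : v ∈ OFV T then
      r ⟨@List.idxOf Var instBEqOfDecidableEq v (OFV T), (@List.idxOf_lt_length_iff Var instBEqOfDecidableEq _ _ _).mpr hv⟩
    else 0

/-- The formal partial derivative `∂T/∂w`: the term `f̄(v₁,…,vₙ)` where
`(v₁,…,vₙ) = OFV T` and `f` sends `(r₁,…,rₙ)` to the defining limit at any
assignment with `s vᵢ = rᵢ`; it is `0̄` if `FV T = ∅`. -/
noncomputable def pderiv (T : Term) (w : Var) : Term :=
  if (OFV T).length = 0 then .const 0
  else .app (OFV T).length (fun r => pderivLim T w (canonAsgn T r))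
      fun i => .var ((OFV T).get i)

/-- `T` is everywhere totally differentiable. -/
def ETDiff (T : Term) : Prop := ∀ w : Var, EDiff T w

/-- Sum of two terms, via the binary function symbol for addition. -/
def Term.add (T U : Term) : Term := .app 2 (fun r => r 0 + r 1) ![T, U]

/-- Product of two terms, via the binary function symbol for multiplication. -/
def Term.mul (T U : Term) : Term := .app 2 (fun r => r 0 * r 1) ![T, U]

/-- Finite sums of terms. -/
def sumList : List Term → Term
  | [] => .const 0
  | T :: rest => T.add (sumList rest)

/-- Finite products of terms. -/
def prodList : List Term → Term
  | [] => .const 1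
  | T :: rest => T.mul (prodList rest)

/-- The total differential `𝐝T = Σᵢ (∂T/∂vᵢ)·dvᵢ` where `(v₁,…,vₙ) = OFV T`. -/
noncomputable def tdiff (T : Term) : Term :=
  sumList ((OFV T).map fun v => (pderiv T v).mul (.var (dvar v)))

/-- `T` is strongly differentiable: every subterm of `T` is everywhere
totally differentiable. -/
def StronglyDiff : Term → Prop
  | .var v => ETDiff (.var v)
  | .const r => ETDiff (.const r)
  | .app n f U => ETDiff (.app n f U) ∧ ∀ i, StronglyDiff (U i)

/-- The extension of `φ₀ : 𝒱 → Terms` to all terms. -/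
def ext (φ₀ : Var → Term) : Term → Term
  | .var v => φ₀ v
  | .const r => .const r
  | .app n f U => .app n f fun i => ext φ₀ (U i)

/-- `φ₀` respects `d` if `φ₀(dv) ≡ 𝐝(φ₀ v)` for every variable `v`. -/
def RespectsD (φ₀ : Var → Term) : Prop :=
  ∀ v : Var, TermEquiv (φ₀ (dvar v)) (tdiff (φ₀ v))

/-- Substitution respecting differentials `T[v|U]` (for `v` a precalculus
variable): replace `v` by `U` and each `dᵏv` by `𝐝ᵏU`. -/
noncomputable def substD (T : Term) (v : Var) (U : Term) : Term :=
  ext (fun w => if w.2 = v.2 then tdiff^[w.1] U else .var w) T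

/-- `π` is a partition of `{1,…,n}` (represented as `Fin n`): a collection of
pairwise disjoint nonempty blocks whose union is everything, i.e. every
element lies in exactly one block and no block is empty. -/
def IsPartitionOf (n : ℕ) (π : Finset (Finset (Fin n))) : Prop :=
  (∀ B ∈ π, B.Nonempty) ∧ ∀ i : Fin n, ∃! B : Finset (Fin n), B ∈ π ∧ i ∈ B

/- `I(π)`: for a partition `π` of `{1,…,n}` with blocks `B₁,…,B_k`, the term
`f̄⁽ᵏ⁾(x₀) · d^{|B₁|}x₀ ⋯ d^{|B_k|}x₀` (here `x₀ = (0,0)` and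
`d^{m}x₀ = (m,0)`). -/
noncomputable def faaTerm (n : ℕ) (f : ℝ → ℝ) (π : Finset (Finset (Fin n))) : Term :=
  (Term.app 1 (fun r => iteratedDeriv π.card f (r 0)) fun _ => .var (0, 0)).mul
    (prodList (π.toList.map fun B => .var (B.card, 0)))

theorem interp_congr_FV (T : Term) (s t : Assignment) (h : ∀ v ∈ FV T, s v = t v) :
    interp T s = interp T t := by
  induction T with
  | var v => exact h v (by simp [FV])
  | const r => rfl
  | app n f U ih =>
    simp only [interp]
    congr 1
    funext i
    exact ih i fun v hv => h v (by simp only [FV, Finset.mem_biUnion]; exact ⟨i, Finset.mem_univ _, hv⟩)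

theorem interp_add' (T U : Term) (s : Assignment) :
    interp (T.add U) s = interp T s + interp U s := by
  simp [Term.add, interp]

theorem interp_mul' (T U : Term) (s : Assignment) :
    interp (T.mul U) s = interp T s * interp U s := by
  simp [Term.mul, interp]

theorem interp_sumList (l : List Term) (s : Assignment) :
    interp (sumList l) s = (l.map fun T => interp T s).sum := by
  induction l with
  | nil => simp [sumList, interp]
  | cons a l ih => simp [sumList, interp_add', ih]

theorem interp_prodList (l : List Term) (s : Assignment) :
    interp (prodList l) s = (l.map fun T => interp T s).prod := by
  induction l with
  | nil => simp [prodList, interp]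
  | cons a l ih => simp [prodList, interp_mul', ih]

theorem pderivLim_congr (T : Term) (w : Var) (s t : Assignment) (hw : s w = t w)
    (h : ∀ v ∈ FV T, s v = t v) : pderivLim T w s = pderivLim T w t := by
  unfold pderivLim
  congr 1
  funext x
  rw [interp_congr_FV T s t h, interp_congr_FV T _ (Function.update t w (t w + x))]
  intro v hv
  by_cases hvw : v = w
  · subst hvw; simp [hw]
  · simp [hvw, h v hv]

theorem pderivLim_eq {T : Term} {w : Var} {s : Assignment} {L : ℝ}
    (h : HasDerivAt (fun x : ℝ => interp T (Function.update s w (s w + x))) L 0) :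
    pderivLim T w s = L := by
  have h2 := hasDerivAt_iff_tendsto_slope_zero.mp h
  refine Tendsto.limUnder_eq (h2.congr fun x => ?_)
  simp [div_eq_inv_mul]

theorem pderivLim_notMem {T : Term} {w : Var} {s : Assignment} (h : w ∉ FV T) :
    pderivLim T w s = 0 := by
  apply pderivLim_eq
  have : (fun x : ℝ => interp T (Function.update s w (s w + x))) = fun _ => interp T s := by
    funext x
    apply interp_congr_FV
    intro v hv
    rw [Function.update_of_ne]
    rintro rfl; exact h hv
  rw [this]
  exact hasDerivAt_const _ _

theorem mem_OFV (T : Term) (v : Var) : v ∈ OFV T ↔ v ∈ FV T := by simp [OFV]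

theorem interp_pderiv (T : Term) (w : Var) (s : Assignment) (hw : w ∈ FV T) :
    interp (pderiv T w) s = pderivLim T w s := by
  have hw' := (mem_OFV T w).2 hw
  have hl : (OFV T).length ≠ 0 := by
    intro h
    rw [List.length_eq_zero_iff] at h
    simp [h] at hw'
  have key : ∀ v ∈ FV T, canonAsgn T (fun i => s ((OFV T).get i)) v = s v := by
    intro v hv
    have hv' := (mem_OFV T v).2 hv
    unfold canonAsgn
    rw [dif_pos hv']
    simp
  unfold pderiv
  rw [if_neg hl]
  simp only [interp]
  exact pderivLim_congr T w _ s (key w hw) key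

theorem interp_tdiff (T : Term) (s : Assignment) (V : Finset Var) (hV : FV T ⊆ V) :
    interp (tdiff T) s = ∑ v ∈ V, pderivLim T v s * s (dvar v) := by
  rw [← Finset.sum_subset hV (fun v _ hv => by rw [pderivLim_notMem hv, zero_mul])]
  unfold tdiff
  rw [interp_sumList, List.map_map, ← Finset.sum_map_toList]
  congr 1
  apply List.map_congr_left
  intro v hv
  simp only [Function.comp, interp_mul', interp]
  rw [interp_pderiv T v s ((mem_OFV T v).1 hv)]

theorem FV_sumList (l : List Term) (V : Finset Var) (h : ∀ T ∈ l, FV T ⊆ V) :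
    FV (sumList l) ⊆ V := by
  induction l with
  | nil => simp [sumList, FV]
  | cons a l ih =>
    intro v hv
    simp only [sumList, Term.add, FV, Finset.mem_biUnion, Finset.mem_univ, true_and,
      Fin.exists_fin_two] at hv
    rcases hv with hv | hv
    · exact h a (by simp) hv
    · exact ih (fun T hT => h T (by simp [hT])) hv

def faaVars (n : ℕ) : Finset Var := (Finset.range (n + 1)).image fun m => (m, 0)

theorem FV_tdiff (T : Term) (n : ℕ) (h : FV T ⊆ faaVars n) : FV (tdiff T) ⊆ faaVars (n + 1) := by
  unfold tdiff
  apply FV_sumList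
  intro U hU
  obtain ⟨v, hv, rfl⟩ := List.mem_map.1 hU
  have hmono : faaVars n ⊆ faaVars (n + 1) :=
    Finset.image_subset_image (Finset.range_mono (by omega))
  intro u hu
  simp only [Term.mul, FV, Finset.mem_biUnion, Finset.mem_univ, true_and,
      Fin.exists_fin_two] at hu
  rcases hu with hu | hu
  · simp only [Matrix.cons_val_zero, pderiv] at hu
    split_ifs at hu
    · simp [FV] at hu
    · simp only [FV, Finset.mem_biUnion, Finset.mem_univ, true_and, Finset.mem_singleton] at hu
      obtain ⟨i, rfl⟩ := hu
      exact hmono (h ((mem_OFV T _).1 (List.get_mem _ _)))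
  · simp only [Matrix.cons_val_one, Matrix.cons_val_fin_one, FV, Finset.mem_singleton] at hu
    subst hu
    have := h ((mem_OFV T _).1 hv)
    simp only [faaVars, Finset.mem_image, Finset.mem_range] at this ⊢
    obtain ⟨m, hm, rfl⟩ := this
    exact ⟨m + 1, by omega, rfl⟩

noncomputable def faaG (f : ℝ → ℝ) (n : ℕ) (s : Assignment) : ℝ :=
  ∑ c : OrderedFinpartition n,
    iteratedDeriv c.length f (s (0, 0)) * ∏ i, s (c.partSize i, 0)

theorem hasDerivAt_faaG (f : ℝ → ℝ) (hf : ContDiff ℝ (⊤ : ℕ∞) f) (n m : ℕ) (s : Assignment) :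
    HasDerivAt (fun x : ℝ => faaG f n (Function.update s (m, 0) (s (m, 0) + x)))
      (∑ c : OrderedFinpartition n,
        ((iteratedDeriv (c.length + 1) f (s (0, 0)) * (if m = 0 then 1 else 0)) *
            ∏ i, s (c.partSize i, 0) +
          iteratedDeriv c.length f (s (0, 0)) *
            ∑ i, (∏ j ∈ Finset.univ.erase i, s (c.partSize j, 0)) *
              (if m = c.partSize i then 1 else 0))) 0 := by
  unfold faaG
  have hup : ∀ k : ℕ, HasDerivAt
      (fun x : ℝ => Function.update s (m, 0) (s (m, 0) + x) (k, 0))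
      (if m = k then 1 else 0) 0 := by
    intro k
    by_cases h : m = k
    · subst h
      simpa using (hasDerivAt_id (0 : ℝ)).const_add (s (m, 0))
    · have : ((k, 0) : Var) ≠ (m, 0) := by simp; omega
      simp only [Function.update_of_ne this, if_neg h]
      exact hasDerivAt_const _ _
  have h0 : ∀ k : ℕ, Function.update s (m, 0) (s (m, 0) + 0) (k, 0) = s (k, 0) := by
    intro k; simp
  apply HasDerivAt.fun_sum
  intro c _
  have h1 : HasDerivAt (iteratedDeriv c.length f) (iteratedDeriv (c.length + 1) f (s (0, 0)))
      (s (0, 0)) := by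
    rw [iteratedDeriv_succ]
    apply DifferentiableAt.hasDerivAt
    exact (hf.differentiable_iteratedDeriv c.length (by exact_mod_cast WithTop.coe_lt_top _)) _
  have h2 := HasDerivAt.comp_of_eq (0 : ℝ) h1 (hup 0) (h0 0).symm
  have h3 := HasDerivAt.fun_finsetProd (u := Finset.univ) fun i _ => hup (c.partSize i)
  have h4 := h2.mul h3
  simp only [h0, Function.comp, smul_eq_mul] at h4
  exact h4

theorem faaG_succ (f : ℝ → ℝ) (n : ℕ) (s : Assignment) :
    faaG f (n + 1) s = ∑ c : OrderedFinpartition n,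
      (iteratedDeriv (c.length + 1) f (s (0, 0)) * (s (1, 0) * ∏ i, s (c.partSize i, 0)) +
        ∑ i, iteratedDeriv c.length f (s (0, 0)) *
          ((∏ j ∈ Finset.univ.erase i, s (c.partSize j, 0)) * s (c.partSize i + 1, 0))) := by
  unfold faaG
  rw [← (OrderedFinpartition.extendEquiv n).sum_comp, Fintype.sum_sigma]
  apply Finset.sum_congr rfl
  intro c _
  rw [Fintype.sum_option]
  congr 1
  · have : ∏ i : Fin (c.length + 1), s ((Fin.cons 1 c.partSize : Fin (c.length + 1) → ℕ) i, 0)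
        = s (1, 0) * ∏ i, s (c.partSize i, 0) := by
      rw [Fin.prod_univ_succ]; simp
    rw [← this]; rfl
  · apply Finset.sum_congr rfl
    intro i _
    have : ∏ j, s (Function.update c.partSize i (c.partSize i + 1) j, 0)
        = (∏ j ∈ Finset.univ.erase i, s (c.partSize j, 0)) * s (c.partSize i + 1, 0) := by
      rw [← Finset.prod_erase_mul _ _ (Finset.mem_univ i)]
      congr 1
      · apply Finset.prod_congr rfl
        intro j hj
        rw [Function.update_of_ne (Finset.ne_of_mem_erase hj)]
      · simp
    rw [← this]; rfl

theorem interp_iter (f : ℝ → ℝ) (hf : ContDiff ℝ (⊤ : ℕ∞) f) (n : ℕ) :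
    FV (tdiff^[n] (.app 1 (fun r => f (r 0)) fun _ => .var (0, 0))) ⊆ faaVars n ∧
    ∀ s, interp (tdiff^[n] (.app 1 (fun r => f (r 0)) fun _ => .var (0, 0))) s = faaG f n s := by
  induction n with
  | zero =>
    constructor
    · simp [FV, faaVars]
    · intro s
      simp [interp, faaG, Fintype.sum_unique, default, OrderedFinpartition.atomic]
  | succ n ih =>
    rw [Function.iterate_succ_apply']
    generalize tdiff^[n] (.app 1 (fun r => f (r 0)) fun _ => .var (0, 0)) = T at ih
    obtain ⟨h1, h2⟩ := ih
    refine ⟨FV_tdiff T n h1, fun s => ?_⟩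
    rw [interp_tdiff T s _ h1, faaVars, Finset.sum_image (by intro a _ b _ h; simpa using h)]
    have h3 : ∀ m, pderivLim T (m, 0) s = _ := fun m =>
      pderivLim_eq (by simp only [h2]; exact hasDerivAt_faaG f hf n m s)
    simp only [h3, faaG_succ, Finset.sum_mul, dvar]
    rw [Finset.sum_comm]
    apply Finset.sum_congr rfl
    intro c _
    simp only [add_mul, Finset.sum_add_distrib, Finset.mul_sum, Finset.sum_mul]
    congr 1
    · rw [Finset.sum_eq_single 0]
      · simp; ring
      · intro b _ hb; simp [hb]
      · simp
    · rw [Finset.sum_comm]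
      apply Finset.sum_congr rfl
      intro i _
      rw [Finset.sum_eq_single (c.partSize i)]
      · simp; ring
      · intro b _ hb; simp [hb]
      · intro h; exact absurd (Finset.mem_range.2 (Nat.lt_succ_of_le (c.partSize_le i))) h

section
open Classical

noncomputable def ofpBlock {n : ℕ} (c : OrderedFinpartition n) (i : Fin c.length) :
    Finset (Fin n) := Finset.univ.image (c.emb i)

noncomputable def ofpParts {n : ℕ} (c : OrderedFinpartition n) : Finset (Finset (Fin n)) :=
  Finset.univ.image (ofpBlock c)

theorem ofpBlock_card {n : ℕ} (c : OrderedFinpartition n) (i : Fin c.length) :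
    (ofpBlock c i).card = c.partSize i := by
  rw [ofpBlock, Finset.card_image_of_injective _ (c.emb_strictMono i).injective]; simp

theorem ofpBlock_eq {n : ℕ} (c : OrderedFinpartition n) {i j : Fin c.length} {x : Fin n}
    (hi : x ∈ ofpBlock c i) (hj : x ∈ ofpBlock c j) : i = j := by
  simp only [ofpBlock, Finset.mem_image, Finset.mem_univ, true_and] at hi hj
  obtain ⟨a, rfl⟩ := hi
  obtain ⟨b, hb⟩ := hj
  by_contra h
  exact c.emb_ne_emb_of_ne h hb.symm

theorem ofpBlock_last {n : ℕ} (c : OrderedFinpartition n) (i : Fin c.length) :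
    IsGreatest (ofpBlock c i : Set (Fin n))
      (c.emb i ⟨c.partSize i - 1, Nat.sub_one_lt_of_lt (c.partSize_pos i)⟩) := by
  constructor
  · simp [ofpBlock]
  · intro x hx
    simp only [ofpBlock, Finset.coe_image, Finset.coe_univ, Set.image_univ, Set.mem_range] at hx
    obtain ⟨a, rfl⟩ := hx
    apply (c.emb_strictMono i).monotone
    rw [Fin.le_def]; have := a.2; simp only; omega

theorem ofpBlock_injective {n : ℕ} (c : OrderedFinpartition n) :
    Function.Injective (ofpBlock c) := by
  intro i j h
  have := (ofpBlock_last c i).1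
  exact ofpBlock_eq c this (h ▸ this)

theorem ofpParts_card {n : ℕ} (c : OrderedFinpartition n) : (ofpParts c).card = c.length := by
  rw [ofpParts, Finset.card_image_of_injective _ (ofpBlock_injective c)]; simp

theorem ofpParts_isPartition {n : ℕ} (c : OrderedFinpartition n) :
    IsPartitionOf n (ofpParts c) := by
  constructor
  · intro B hB
    simp only [ofpParts, Finset.mem_image, Finset.mem_univ, true_and] at hB
    obtain ⟨i, rfl⟩ := hB
    exact ⟨_, (ofpBlock_last c i).1⟩
  · intro x
    obtain ⟨m, a, rfl⟩ := c.cover x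
    have hm : c.emb m a ∈ ofpBlock c m := by simp [ofpBlock]
    refine ⟨ofpBlock c m, ⟨by simp [ofpParts], hm⟩, ?_⟩
    rintro B ⟨hB, hx⟩
    simp only [ofpParts, Finset.mem_image, Finset.mem_univ, true_and] at hB
    obtain ⟨i, rfl⟩ := hB
    rw [ofpBlock_eq c hx hm]

theorem ofpParts_last_range {n : ℕ} (c : OrderedFinpartition n) :
    Set.range (fun i => c.emb i ⟨c.partSize i - 1, Nat.sub_one_lt_of_lt (c.partSize_pos i)⟩) =
      {x | ∃ B ∈ ofpParts c, IsGreatest (B : Set (Fin n)) x} := by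
  ext x
  simp only [Set.mem_range, Set.mem_ofPred_eq, ofpParts, Finset.mem_image, Finset.mem_univ,
    true_and, exists_exists_eq_and]
  constructor
  · rintro ⟨i, rfl⟩; exact ⟨i, ofpBlock_last c i⟩
  · rintro ⟨i, h⟩; exact ⟨i, (ofpBlock_last c i).unique h⟩

theorem ofp_strictMono_unique {k n : ℕ} {g h : Fin k → Fin n} (hg : StrictMono g)
    (hh : StrictMono h) (e : Set.range g = Set.range h) : g = h :=
  (StrictMono.range_inj hg hh).1 e

theorem ofpParts_injective {n : ℕ} :
    Function.Injective (ofpParts : OrderedFinpartition n → _) := by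
  intro c c' h
  have hl : c.length = c'.length := by rw [← ofpParts_card, ← ofpParts_card, h]
  have hr : Set.range (fun i => c.emb i ⟨c.partSize i - 1, Nat.sub_one_lt_of_lt (c.partSize_pos i)⟩) =
    Set.range (fun i => c'.emb i ⟨c'.partSize i - 1, Nat.sub_one_lt_of_lt (c'.partSize_pos i)⟩) := by
    rw [ofpParts_last_range, ofpParts_last_range, h]
  have hB : ∀ i : Fin c.length, ofpBlock c i = ofpBlock c' (Fin.cast hl i) := by
    intro i
    have hlast := ofp_strictMono_unique c.parts_strictMono
      (c'.parts_strictMono.comp (Fin.cast_strictMono hl))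
      (by rw [hr]; exact ((finCongr hl).surjective.range_comp _).symm)
    have hx := (ofpBlock_last c i).1
    have hx' := (ofpBlock_last c' (Fin.cast hl i)).1
    have hi := congrFun hlast i
    simp only [Function.comp] at hi
    rw [← hi] at hx'
    refine ((ofpParts_isPartition c).2 _).unique ⟨by simp [ofpParts], hx⟩ ⟨?_, hx'⟩
    rw [h]; simp [ofpParts]
  have hs : ∀ i : Fin c.length, c.partSize i = c'.partSize (Fin.cast hl i) := by
    intro i; rw [← ofpBlock_card, ← ofpBlock_card, hB]
  have he : ∀ (i : Fin c.length) a, c.emb i a = c'.emb (Fin.cast hl i) (Fin.cast (hs i) a) := by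
    intro i a
    have := ofp_strictMono_unique (c.emb_strictMono i)
      ((c'.emb_strictMono (Fin.cast hl i)).comp (Fin.cast_strictMono (hs i))) (by
        have h1 := congrArg (fun B : Finset (Fin n) => (B : Set (Fin n))) (hB i)
        simp only [ofpBlock, Finset.coe_image, Finset.coe_univ, Set.image_univ] at h1
        rw [h1]
        exact ((finCongr (hs i)).surjective.range_comp _).symm)
    exact congrFun this a
  clear hr hB h
  rcases c with ⟨l, p, _, e, _, _, _, _⟩
  rcases c' with ⟨l', p', _, e', _, _, _, _⟩
  simp only at hl
  subst hl
  have : p = p' := funext hs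
  subst this
  have : e = e' := by funext i a; exact he i a
  subst this
  rfl

theorem ofpParts_surjective {n : ℕ} (π : Finset (Finset (Fin n))) (h : IsPartitionOf n π) :
    ∃ c : OrderedFinpartition n, ofpParts c = π := by
  let M : Finset (Fin n) :=
    Finset.univ.filter fun x => ∃ B ∈ π, IsGreatest (B : Set (Fin n)) x
  have hM : ∀ i : Fin M.card, ∃ B ∈ π, IsGreatest (B : Set (Fin n)) (M.orderEmbOfFin rfl i) := by
    intro i
    exact (Finset.mem_filter.1 (M.orderEmbOfFin_mem rfl i)).2
  choose blk hπ hg using hM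
  have hsurj : ∀ B ∈ π, ∃ i, blk i = B := by
    intro B hB
    have hne := h.1 B hB
    have hgB : IsGreatest (B : Set (Fin n)) (B.max' hne) := B.isGreatest_max' hne
    have hm : B.max' hne ∈ M := Finset.mem_filter.2 ⟨Finset.mem_univ _, B, hB, hgB⟩
    have : B.max' hne ∈ Set.range (M.orderEmbOfFin rfl) := by
      rw [Finset.range_orderEmbOfFin]; exact hm
    obtain ⟨i, hi⟩ := this
    refine ⟨i, (h.2 (B.max' hne)).unique ⟨hπ i, ?_⟩ ⟨hB, hgB.1⟩⟩
    rw [← hi]; exact (hg i).1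
  have hrange : ∀ i, Set.range ((blk i).orderEmbOfFin rfl) = (blk i : Set (Fin n)) :=
    fun i => Finset.range_orderEmbOfFin _ rfl
  have hpos : ∀ i, 0 < (blk i).card := fun i => Finset.card_pos.2 (h.1 _ (hπ i))
  let c : OrderedFinpartition n :=
    { length := M.card
      partSize := fun i => (blk i).card
      partSize_pos := hpos
      emb := fun i => (blk i).orderEmbOfFin rfl
      emb_strictMono := fun i => ((blk i).orderEmbOfFin rfl).strictMono
      parts_strictMono := by
        have : (fun m => (blk m).orderEmbOfFin rfl
            ⟨(blk m).card - 1, Nat.sub_one_lt_of_lt (hpos m)⟩) = M.orderEmbOfFin rfl := by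
          funext m
          rw [Finset.orderEmbOfFin_last rfl (hpos m)]
          exact ((blk m).isGreatest_max' _).unique (hg m)
        rw [this]
        exact (M.orderEmbOfFin rfl).strictMono
      disjoint := by
        intro i _ j _ hij
        simp only [Function.onFun, hrange]
        rw [Set.disjoint_left]
        intro x hx hx'
        apply hij
        have hb : blk i = blk j := (h.2 x).unique ⟨hπ i, hx⟩ ⟨hπ j, hx'⟩
        have h1 := hg i
        rw [hb] at h1
        exact (M.orderEmbOfFin rfl).injective (h1.unique (hg j))
      cover := by
        intro x
        obtain ⟨B, ⟨hB, hx⟩, _⟩ := h.2 x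
        obtain ⟨i, rfl⟩ := hsurj B hB
        exact ⟨i, by rw [hrange]; exact hx⟩ }
  have hblk : ∀ i, ofpBlock c i = blk i := by
    intro i
    apply Finset.coe_injective
    simp only [ofpBlock, Finset.coe_image, Finset.coe_univ, Set.image_univ]
    exact hrange i
  refine ⟨c, ?_⟩
  ext B
  simp only [ofpParts, Finset.mem_image, Finset.mem_univ, true_and, hblk]
  constructor
  · rintro ⟨i, rfl⟩; exact hπ i
  · exact hsurj B

theorem faaG_eq_sum (f : ℝ → ℝ) (n : ℕ) (s : Assignment) :
    faaG f n s = ∑ π ∈ Finset.univ.filter (IsPartitionOf n),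
      iteratedDeriv π.card f (s (0, 0)) * ∏ B ∈ π, s (B.card, 0) := by
  unfold faaG
  refine Finset.sum_bij (fun c _ => ofpParts c) ?_ ?_ ?_ ?_
  · intro c _; simpa using ofpParts_isPartition c
  · intro c _ c' _ h; exact ofpParts_injective h
  · intro π hπ
    obtain ⟨c, hc⟩ := ofpParts_surjective π (Finset.mem_filter.1 hπ).2
    exact ⟨c, Finset.mem_univ _, hc⟩
  · intro c _
    rw [ofpParts_card]
    congr 1
    rw [ofpParts, Finset.prod_image (fun a _ b _ h => ofpBlock_injective c h)]
    simp only [ofpBlock_card]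

end

/- For infinitely differentiable `f : ℝ → ℝ` and `n ≥ 1`,
`𝐝ⁿ(f̄(x₀)) ≡ Σ_{π ∈ Πₙ} I(π)`. -/
open Classical in
theorem tdiff_iterate_equiv_sum_partitions (f : ℝ → ℝ) (hf : ContDiff ℝ (⊤ : ℕ∞) f)
    (n : ℕ) (hn : 1 ≤ n) :
    TermEquiv (tdiff^[n] (.app 1 (fun r => f (r 0)) fun _ => .var (0, 0)))
      (sumList (((Finset.univ.filter (IsPartitionOf n)).toList).map
        (faaTerm n f))) := by
  intro s
  rw [(interp_iter f hf n).2 s, faaG_eq_sum, interp_sumList, List.map_map, ← Finset.sum_map_toList]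
  congr 1
  apply List.map_congr_left
  intro π _
  simp only [Function.comp, faaTerm, interp_mul', interp_prodList, interp, List.map_map]
  congr 1
  rw [← Finset.prod_map_toList]
  rfl
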